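/- Let p be a prime, G an abelian p-group, h ∈ ℕ, and suppose A = {a_s(n_s)}_{s=1}^k is a (d*(G)+p^h)-cover of ℤ. Let c_1,...,c_k ∈ G and m_1,...,m_k ∈ ℤ, let c ∈ G and α ∈ ℚ, and put 𝓘 = {I ⊆ {1,...,k} : Σ_{s∈I} c_s = c and Σ_{s∈I} m_s/n_s ∈ α + p^h ℤ}. Then Σ_{I∈𝓘} (−1)^{|I|} e^{2πi Σ_{s∈I} a_s m_s/n_s} ≡ 0 (mod p) in the ring of algebraic integers. -/

import Mathlib

/-- A product of more than `#D` factors `1 + w s` that vanish, expanded over subsets, still vanishes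
after weighting by a product of `#D` affine functions of the subset. -/
theorem sum_powerset_prod_mul_prod_affine_eq_zero {ι κ R : Type*} [DecidableEq ι] [CommRing R]
    [DecidableEq R] (w : ι → R) (v : κ → ι → R) (D : Finset κ) (u : κ → R) (J : Finset ι)
    (hJ : D.card < (J.filter fun s => w s = -1).card) :
    ∑ I ∈ J.powerset, (∏ s ∈ I, w s) * ∏ i ∈ D, (u i + ∑ s ∈ I, v i s) = 0 := by
  classical
  induction D using Finset.induction_on generalizing u J with
  | empty =>
    simp only [Finset.prod_empty, mul_one, ← Finset.prod_one_add]
    obtain ⟨s, hs⟩ := Finset.card_pos.mp (by simpa using hJ)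
    rw [Finset.mem_filter] at hs
    exact Finset.prod_eq_zero hs.1 (by simp [hs.2])
  | insert i D hi ih =>
    rw [Finset.card_insert_of_notMem hi] at hJ
    have expand : ∀ I ∈ J.powerset,
        (∏ s ∈ I, w s) * ∏ j ∈ insert i D, (u j + ∑ s ∈ I, v j s) =
          u i * ((∏ s ∈ I, w s) * ∏ j ∈ D, (u j + ∑ s ∈ I, v j s)) +
          ∑ s ∈ J, if s ∈ I then
            v i s * ((∏ s ∈ I, w s) * ∏ j ∈ D, (u j + ∑ s ∈ I, v j s)) else 0 := by
      intro I hI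
      rw [Finset.prod_insert hi, ← Finset.sum_filter, ← Finset.sum_mul,
        Finset.filter_mem_eq_inter, Finset.inter_eq_right.mpr (Finset.mem_powerset.mp hI)]
      ring
    rw [Finset.sum_congr rfl expand, Finset.sum_add_distrib, ← Finset.mul_sum,
      ih u J (by omega), mul_zero, zero_add, Finset.sum_comm]
    refine Finset.sum_eq_zero fun s hs => ?_
    have key := ih (fun j => u j + v j s) (J.erase s) (by
      rw [Finset.filter_erase]
      exact lt_of_lt_of_le (by omega) Finset.pred_card_le_card_erase)
    have hsplit : J = insert s (J.erase s) := (Finset.insert_erase hs).symm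
    rw [hsplit, Finset.sum_powerset_insert (Finset.notMem_erase s J)]
    have hnot : ∀ I ∈ (J.erase s).powerset, s ∉ I := fun I hI hsI =>
      Finset.notMem_erase s J (Finset.mem_powerset.mp hI hsI)
    rw [Finset.sum_eq_zero fun I hI => if_neg (hnot I hI), zero_add]
    calc _ = ∑ I ∈ (J.erase s).powerset, v i s * w s *
          ((∏ s ∈ I, w s) * ∏ j ∈ D, (u j + v j s + ∑ s ∈ I, v j s)) := by
          refine Finset.sum_congr rfl fun I hI => ?_
          rw [if_pos (Finset.mem_insert_self s I), Finset.prod_insert (hnot I hI)]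
          simp only [Finset.sum_insert (hnot I hI), add_assoc]
          ring
      _ = 0 := by rw [← Finset.mul_sum, key, mul_zero]

theorem Int.natCast_mul_choose_eq (z : ℤ) (n : ℕ) :
    ((n + 1 : ℕ) : ℤ) * Ring.choose z (n + 1) = z * Ring.choose (z - 1) n := by
  have := Ring.choose_smul_choose z (n := n + 1) (k := 1) (by omega)
  simpa using this

theorem Int.dvd_of_prime_pow_dvd_mul {p : ℕ} (hp : p.Prime) {h : ℕ} {x y : ℤ}
    (hxy : (p : ℤ) ^ h ∣ x * y) (hx : ¬ (p : ℤ) ^ h ∣ x) : (p : ℤ) ∣ y := by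
  by_contra hy
  exact hx ((Nat.prime_iff_prime_int.mp hp).pow_dvd_of_dvd_mul_right h hy hxy)

theorem Int.prime_dvd_choose_sub_one {p : ℕ} (hp : p.Prime) (h : ℕ) {z : ℤ}
    (hz : ¬ (p : ℤ) ^ h ∣ z) : (p : ℤ) ∣ Ring.choose (z - 1) (p ^ h - 1) := by
  refine Int.dvd_of_prime_pow_dvd_mul hp (h := h) ?_ hz
  rw [← Int.natCast_mul_choose_eq, Nat.sub_add_cancel (Nat.one_le_pow _ _ hp.pos)]
  push_cast
  exact dvd_mul_right _ _

theorem Int.prime_dvd_choose_sub_one_sub {p : ℕ} (hp : p.Prime) (h : ℕ) {z : ℤ}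
    (hz : (p : ℤ) ^ h ∣ z) {j : ℕ} (hj : j < p ^ h) :
    (p : ℤ) ∣ Ring.choose (z - 1) j - (-1) ^ j := by
  induction j with
  | zero => simp
  | succ j ih =>
    have hdvd : (p : ℤ) ∣ Ring.choose z (j + 1) := by
      refine Int.dvd_of_prime_pow_dvd_mul hp (h := h) (x := ((j + 1 : ℕ) : ℤ)) ?_ ?_
      · rw [Int.natCast_mul_choose_eq]
        exact hz.mul_right _
      · intro hd
        exact absurd (Nat.le_of_dvd (by omega) (by exact_mod_cast hd)) (not_le.mpr hj)
    have hpascal := Ring.choose_succ_succ (z - 1) j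
    rw [sub_add_cancel] at hpascal
    obtain ⟨r, hr⟩ := dvd_sub hdvd (ih (by omega))
    exact ⟨r, by rw [← hr, hpascal, pow_succ]; ring⟩

theorem Int.exists_choose_sub_one_eq {p : ℕ} (hp : p.Prime) (h : ℕ) (z : ℤ) :
    ∃ r : ℤ, Ring.choose (z - 1) (p ^ h - 1) = (if (p : ℤ) ^ h ∣ z then 1 else 0) + p * r := by
  split_ifs with hz
  · have hlt : p ^ h - 1 < p ^ h := Nat.sub_lt (pow_pos hp.pos _) one_pos
    have hsign : (p : ℤ) ∣ (-1) ^ (p ^ h - 1) - 1 := by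
      rcases hp.eq_two_or_odd' with rfl | hodd
      · rcases neg_one_pow_eq_or ℤ (2 ^ h - 1) with e | e <;> rw [e] <;> norm_num
      · rw [(Nat.Odd.sub_odd hodd.pow odd_one).neg_one_pow]
        simp
    obtain ⟨r, hr⟩ := dvd_add (Int.prime_dvd_choose_sub_one_sub hp h hz hlt) hsign
    exact ⟨r, by linarith⟩
  · obtain ⟨r, hr⟩ := Int.prime_dvd_choose_sub_one hp h hz
    exact ⟨r, by rw [hr, zero_add]⟩

theorem Int.prod_range_sub_eq_factorial_mul_choose (z : ℤ) (n : ℕ) :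
    ∏ j ∈ Finset.range n, (z - j) = (n.factorial : ℤ) * Ring.choose z n := by
  rw [← descPochhammer_eval_eq_prod_range, ← nsmul_eq_mul,
    ← Ring.descPochhammer_eq_factorial_smul_choose, Polynomial.eval_eq_smeval]

theorem exists_prod_choose_eq {τ : Type*} [DecidableEq τ] {p : ℕ} (hp : p.Prime) (e : τ → ℕ)
    (z : τ → ℤ) (T : Finset τ) :
    ∃ r : ℤ, ∏ t ∈ T, Ring.choose (z t - 1) (p ^ e t - 1) =
      (if ∀ t ∈ T, (p : ℤ) ^ e t ∣ z t then 1 else 0) + p * r := by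
  induction T using Finset.induction_on with
  | empty => exact ⟨0, by simp⟩
  | insert t T ht ih =>
    obtain ⟨r, hr⟩ := ih
    obtain ⟨r', hr'⟩ := Int.exists_choose_sub_one_eq hp (e t) (z t)
    simp only [Finset.prod_insert ht, hr, hr', Finset.forall_mem_insert]
    by_cases h₁ : (p : ℤ) ^ e t ∣ z t <;> by_cases h₂ : ∀ t ∈ T, (p : ℤ) ^ e t ∣ z t
    · exact ⟨r' + r + p * r' * r, by rw [if_pos h₁, if_pos h₂, if_pos ⟨h₁, h₂⟩]; ring⟩
    · exact ⟨r + p * r' * r, by rw [if_pos h₁, if_neg h₂, if_neg fun h => h₂ h.2]; ring⟩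
    · exact ⟨r' + p * r' * r, by rw [if_neg h₁, if_pos h₂, if_neg fun h => h₁ h.1]; ring⟩
    · exact ⟨p * r' * r, by rw [if_neg h₁, if_neg h₂, if_neg fun h => h₁ h.1]; ring⟩

/-- The additive character `β ↦ exp (2πiβ)` on `ℚ`. -/
noncomputable def ratExp (β : ℚ) : ℂ := Complex.exp (2 * Real.pi * Complex.I * (β : ℂ))

theorem ratExp_add (β γ : ℚ) : ratExp (β + γ) = ratExp β * ratExp γ := by
  simp [ratExp, mul_add, Complex.exp_add]

theorem ratExp_sum {ι : Type*} (I : Finset ι) (f : ι → ℚ) :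
    ratExp (∑ s ∈ I, f s) = ∏ s ∈ I, ratExp (f s) := by
  simp [ratExp, Finset.mul_sum, Complex.exp_sum]

theorem ratExp_nat_mul (n : ℕ) (β : ℚ) : ratExp (n * β) = ratExp β ^ n := by
  rw [ratExp, ratExp, ← Complex.exp_nat_mul]
  push_cast
  ring_nf

theorem ratExp_eq_one_iff {β : ℚ} : ratExp β = 1 ↔ ∃ z : ℤ, β = z := by
  rw [ratExp, Complex.exp_eq_one_iff]
  refine exists_congr fun z => ?_
  rw [mul_comm (2 * (Real.pi : ℂ) * Complex.I), mul_left_inj' Complex.two_pi_I_ne_zero]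
  norm_cast

theorem isIntegral_ratExp (β : ℚ) : IsIntegral ℤ (ratExp β) := by
  refine IsIntegral.of_pow β.den_pos ?_
  rw [← ratExp_nat_mul, ratExp_eq_one_iff.mpr ⟨β.num, by rw [mul_comm, Rat.mul_den_eq_num]⟩]
  exact isIntegral_one

open scoped Classical in
theorem sum_range_ratExp_pow {N : ℕ} {β : ℚ} (hβ : ∃ z : ℤ, N * β = z) :
    ∑ x ∈ Finset.range N, ratExp β ^ x = if ∃ z : ℤ, β = z then (N : ℂ) else 0 := by
  split_ifs with h
  · simp [ratExp_eq_one_iff.mpr h]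
  · have hne : ratExp β - 1 ≠ 0 := sub_ne_zero.mpr fun h' => h (ratExp_eq_one_iff.mp h')
    have hgeom := geom_sum_mul (ratExp β) N
    rw [← ratExp_nat_mul, ratExp_eq_one_iff.mpr hβ, sub_self] at hgeom
    exact (mul_eq_zero.mp hgeom).resolve_right hne

open scoped Classical in
/-- If every integer lies in more than `#D` of the classes `a s (mod n s)`, then a product of `#D`
affine functions of the subset `I` is orthogonal to `(-1)^#I exp (2πi ∑ a_s m_s / n_s)` over the
subsets with `∑ m_s / n_s ≡ α (mod 1)`. -/
theorem sum_ratExp_mul_prod_affine_eq_zero {ι κ : Type*} [Fintype ι] (a : ι → ℤ) (n : ι → ℕ)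
    (hn : ∀ s, 0 < n s) (m : ι → ℤ) (α : ℚ) (D : Finset κ) (u : κ → ℚ) (v : κ → ι → ℚ)
    (hcover : ∀ x : ℤ, D.card < (Finset.univ.filter fun s : ι => (n s : ℤ) ∣ x - a s).card) :
    ∑ I ∈ Finset.univ.filter (fun I : Finset ι =>
        ∃ z : ℤ, ∑ s ∈ I, (m s : ℚ) / (n s : ℚ) = α + z),
      ((-1) ^ I.card * ratExp (∑ s ∈ I, (a s * m s : ℚ) / (n s : ℚ))) *
        ((∏ i ∈ D, (u i + ∑ s ∈ I, v i s) : ℚ) : ℂ) = 0 := by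
  set W : Finset ι → ℂ := fun I => ((-1) ^ I.card * ratExp (∑ s ∈ I, (a s * m s : ℚ) / (n s : ℚ))) *
        ((∏ i ∈ D, (u i + ∑ s ∈ I, v i s) : ℚ) : ℂ) with hW
  set θ : Finset ι → ℚ := fun I => α - ∑ s ∈ I, (m s : ℚ) / (n s : ℚ) with hθ
  have twisted : ∀ x : ℕ, ∑ I : Finset ι, W I * ratExp (θ I) ^ x = 0 := by
    intro x
    have key := sum_powerset_prod_mul_prod_affine_eq_zero
      (fun s => -ratExp ((a s - x) * m s / n s)) (fun i s => (v i s : ℂ)) D (fun i => (u i : ℂ))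
      Finset.univ ((hcover x).trans_le (Finset.card_le_card fun s hs => by
        simp only [Finset.mem_filter, Finset.mem_univ, true_and] at hs ⊢
        obtain ⟨q, hq⟩ := hs
        rw [neg_inj, ratExp_eq_one_iff]
        refine ⟨-q * m s, ?_⟩
        have hq' : (x : ℚ) - a s = n s * q := by exact_mod_cast hq
        have hns : (n s : ℚ) ≠ 0 := by exact_mod_cast (hn s).ne'
        rw [div_eq_iff hns]
        push_cast
        linear_combination (-(m s : ℚ)) * hq'))
    rw [Finset.powerset_univ] at key
    calc _ = ∑ I : Finset ι, ratExp α ^ x * ((∏ s ∈ I, -ratExp ((a s - x) * m s / n s)) *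
          ∏ i ∈ D, ((u i : ℂ) + ∑ s ∈ I, (v i s : ℂ))) := by
          refine Finset.sum_congr rfl fun I _ => ?_
          have hphase : ratExp (∑ s ∈ I, (a s * m s : ℚ) / (n s : ℚ)) * ratExp (θ I) ^ x =
              ratExp α ^ x * ∏ s ∈ I, ratExp ((a s - x) * m s / n s) := by
            rw [← ratExp_nat_mul, ← ratExp_nat_mul, ← ratExp_sum, ← ratExp_add, ← ratExp_add]
            congr 1
            simp only [hθ, sub_mul, sub_div, Finset.sum_sub_distrib, mul_sub, Finset.mul_sum,
              mul_div_assoc]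
            ring
          rw [Finset.prod_neg, hW]
          push_cast
          linear_combination ((-1) ^ I.card * ∏ i ∈ D, ((u i : ℂ) + ∑ s ∈ I, (v i s : ℂ))) * hphase
      _ = 0 := by rw [← Finset.mul_sum, key, mul_zero]
  obtain ⟨N, hN0, hN⟩ : ∃ N : ℕ, N ≠ 0 ∧ ∀ I : Finset ι, ∃ z : ℤ, N * θ I = z := by
    refine ⟨∏ I : Finset ι, (θ I).den, Finset.prod_ne_zero_iff.mpr fun I _ => (θ I).den_ne_zero,
      fun I => ?_⟩
    obtain ⟨b, hb⟩ := Finset.dvd_prod_of_mem (fun I : Finset ι => (θ I).den) (Finset.mem_univ I)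
    refine ⟨b * (θ I).num, ?_⟩
    rw [hb]
    push_cast
    linear_combination (b : ℚ) * Rat.mul_den_eq_num (θ I)
  have total : ∑ I : Finset ι, W I * ∑ x ∈ Finset.range N, ratExp (θ I) ^ x = 0 := by
    simp only [Finset.mul_sum]
    rw [Finset.sum_comm]
    exact Finset.sum_eq_zero fun x _ => twisted x
  simp only [sum_range_ratExp_pow (hN _), mul_ite, mul_zero] at total
  rw [← Finset.sum_filter, ← Finset.sum_mul] at total
  have hfilter : ∀ I : Finset ι, (∃ z : ℤ, θ I = z) ↔
      ∃ z : ℤ, ∑ s ∈ I, (m s : ℚ) / (n s : ℚ) = α + z := fun I =>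
    ⟨fun ⟨z, hz⟩ => ⟨-z, by push_cast; simp only [hθ] at hz; linarith⟩,
      fun ⟨z, hz⟩ => ⟨-z, by push_cast; simp only [hθ]; linarith⟩⟩
  simp only [hfilter] at total
  exact (mul_eq_zero.mp total).resolve_right (by exact_mod_cast hN0)

theorem ZMod.pow_dvd_sum_val_sub_val_iff {ι : Type*} {p h : ℕ} (hp : p.Prime)
    (f : ι → ZMod (p ^ h)) (b : ZMod (p ^ h)) (I : Finset ι) :
    (p : ℤ) ^ h ∣ ∑ s ∈ I, ((f s).val : ℤ) - (b.val : ℤ) ↔ ∑ s ∈ I, f s = b := by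
  have : NeZero (p ^ h) := ⟨pow_ne_zero _ hp.ne_zero⟩
  rw [← Nat.cast_pow, ← ZMod.intCast_zmod_eq_zero_iff_dvd]
  push_cast
  simp only [ZMod.natCast_val, ZMod.cast_id', id_eq, sub_eq_zero]

open scoped Classical in
/-- **Main Theorem (Theorem 2.1), congruence form.**
If `{a s (n s)}_{s=1}^k` is a `(d*(G)+p^h)`-cover of `ℤ`, where `G = ⨁_t ℤ/p^{hvec t}ℤ`
and `d*(G) = ∑_t (p^{hvec t} - 1)`, and
`𝓘 = {I ⊆ {1,…,k} : ∑_{s∈I} c_s = c ∧ ∑_{s∈I} m_s/n_s ∈ α + p^h ℤ}`, then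
`∑_{I∈𝓘} (−1)^{|I|} e^{2πi ∑_{s∈I} a_s m_s/n_s} ≡ 0 (mod p)` in the ring of
algebraic integers, i.e. the sum equals `p` times an algebraic integer. -/
theorem stmt2 (p : ℕ) (hp : p.Prime) (l : ℕ) (hvec : Fin l → ℕ) (h : ℕ)
    (k : ℕ) (a : Fin k → ℤ) (n : Fin k → ℕ) (hn : ∀ s, 0 < n s)
    (hcover : ∀ x : ℤ,
      (∑ t, (p ^ hvec t - 1)) + p ^ h ≤
        (Finset.univ.filter fun s : Fin k => (n s : ℤ) ∣ x - a s).card)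
    (c : Fin k → (∀ t, ZMod (p ^ hvec t))) (m : Fin k → ℤ)
    (c₀ : ∀ t, ZMod (p ^ hvec t)) (α : ℚ) :
    ∃ ω : ℂ, IsIntegral ℤ ω ∧
      ∑ I ∈ Finset.univ.filter (fun I : Finset (Fin k) =>
          (∑ s ∈ I, c s) = c₀ ∧
            ∃ z : ℤ, ∑ s ∈ I, (m s : ℚ) / (n s : ℚ) = α + (p : ℚ) ^ h * z),
        (-1 : ℂ) ^ I.card *
          Complex.exp (2 * Real.pi * Complex.I *
            ((∑ s ∈ I, (a s * m s : ℚ) / (n s : ℚ) : ℚ) : ℂ))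
        = (p : ℂ) * ω := by
  classical
  set e : Option (Fin l) → ℕ := fun t => t.elim h hvec with he
  set T : Finset (Finset (Fin k)) := Finset.univ.filter fun I =>
    ∃ z : ℤ, ∑ s ∈ I, (m s : ℚ) / (n s : ℚ) = α + z with hT
  set w : Finset (Fin k) → ℂ := fun I =>
    (-1) ^ I.card * ratExp (∑ s ∈ I, (a s * m s : ℚ) / (n s : ℚ))
  set u : Option (Fin l) → ℚ := fun t => t.elim (-α) fun t => -((c₀ t).val : ℚ) with hu
  set v : Option (Fin l) → Fin k → ℚ := fun t s =>
    t.elim ((m s : ℚ) / n s) fun t => ((c s t).val : ℚ) with hv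
  set D : Finset (Σ _ : Option (Fin l), ℕ) :=
    Finset.univ.sigma fun t => Finset.range (p ^ e t - 1) with hD
  have hDcard : D.card < (∑ t, (p ^ hvec t - 1)) + p ^ h := by
    have : 0 < p ^ h := pow_pos hp.pos _
    simp only [hD, Finset.card_sigma, Finset.card_range, Fintype.sum_option, he, Option.elim]
    omega
  have vanish := sum_ratExp_mul_prod_affine_eq_zero a n hn m α D
    (fun i => u i.1 - 1 - i.2) (fun i => v i.1) fun x => hDcard.trans_le (hcover x)
  have evaluate : ∀ I ∈ T, ∃ r : ℤ,
      ∏ i ∈ D, (u i.1 - 1 - i.2 + ∑ s ∈ I, v i.1 s) =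
        (∏ t, ((p ^ e t - 1).factorial : ℚ)) *
          ((if (∑ s ∈ I, c s) = c₀ ∧
            ∃ z : ℤ, ∑ s ∈ I, (m s : ℚ) / (n s : ℚ) = α + (p : ℚ) ^ h * z then 1 else 0)
            + p * r) := by
    intro I hI
    obtain ⟨y, hy⟩ := (Finset.mem_filter.mp hI).2
    set z : Option (Fin l) → ℤ := fun t =>
      t.elim y fun t => ∑ s ∈ I, ((c s t).val : ℤ) - ((c₀ t).val : ℤ) with hz
    have hzcast : ∀ t, u t + ∑ s ∈ I, v t s = z t := by
      rintro (_ | t)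
      · simp only [hu, hv, hz, Option.elim]
        linarith
      · simp only [hu, hv, hz, Option.elim]
        push_cast
        ring
    have hcond : (∀ t ∈ Finset.univ, (p : ℤ) ^ e t ∣ z t) ↔ ((∑ s ∈ I, c s) = c₀ ∧
        ∃ z : ℤ, ∑ s ∈ I, (m s : ℚ) / (n s : ℚ) = α + (p : ℚ) ^ h * z) := by
      simp only [Finset.mem_univ, true_imp_iff, Option.forall, he, hz, Option.elim, funext_iff,
        Finset.sum_apply, ZMod.pow_dvd_sum_val_sub_val_iff hp]
      rw [and_comm, hy]
      refine and_congr_right fun _ => exists_congr fun b => ?_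
      rw [add_right_inj]
      norm_cast
    obtain ⟨r, hr⟩ := exists_prod_choose_eq hp e z Finset.univ
    simp only [hcond] at hr
    refine ⟨r, ?_⟩
    rw [hD, Finset.prod_sigma]
    calc _ = ((∏ t, ∏ j ∈ Finset.range (p ^ e t - 1), (z t - 1 - j) : ℤ) : ℚ) := by
          push_cast
          refine Finset.prod_congr rfl fun t _ => Finset.prod_congr rfl fun j _ => ?_
          rw [← hzcast]
          ring
      _ = _ := by
          simp only [Int.prod_range_sub_eq_factorial_mul_choose, Finset.prod_mul_distrib, hr]
          push_cast
          rfl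
  choose! r hr using evaluate
  refine ⟨-∑ I ∈ T, w I * r I, ?_, ?_⟩
  · refine (IsIntegral.sum _ fun I _ => ?_).neg
    exact (((isIntegral_one.neg).pow _).mul (isIntegral_ratExp _)).mul isIntegral_algebraMap
  · have hF : (∏ t, ((p ^ e t - 1).factorial : ℂ)) ≠ 0 :=
      Finset.prod_ne_zero_iff.mpr fun t _ => by exact_mod_cast Nat.factorial_ne_zero _
    have hsplit : (∏ t, ((p ^ e t - 1).factorial : ℂ)) * ((∑ I ∈ T, if (∑ s ∈ I, c s) = c₀ ∧
        ∃ z : ℤ, ∑ s ∈ I, (m s : ℚ) / (n s : ℚ) = α + (p : ℚ) ^ h * z then w I else 0) +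
        p * ∑ I ∈ T, w I * r I) = 0 := by
      refine Eq.trans ?_ vanish
      rw [Finset.mul_sum, ← Finset.sum_add_distrib, Finset.mul_sum]
      refine Finset.sum_congr rfl fun I hI => ?_
      rw [hr I hI]
      push_cast
      split_ifs <;> ring
    have hsum := (mul_eq_zero.mp hsplit).resolve_left hF
    rw [← Finset.sum_filter, hT, Finset.filter_filter] at hsum
    rw [mul_neg, ← add_eq_zero_iff_eq_neg, ← hsum]
    congr 1
    refine Finset.sum_congr (Finset.filter_congr fun I _ => ?_) fun I _ => rfl
    refine ⟨fun hI => ⟨?_, hI⟩, And.right⟩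
    obtain ⟨-, z, hz⟩ := hI
    exact ⟨p ^ h * z, by rw [hz]; push_cast; rfl⟩
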